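/- Let H : B_R → ℝ² be a smooth vector field vanishing on ∂B_R and let a > 0. Then ∫_{B_R} |∇²H|² x̄^a dx ≤ ∫_{B_R} |ΔH|² x̄^a dx + (1/2)∫_{B_R} |∇²H|² x̄^a dx + C ∫_{B_R} |∇H|² x̄^a dx, where C depends only on a and η₀; consequently ∫ |∇²H|² x̄^a dx ≤ 2∫ |ΔH|² x̄^a dx + 2C ∫ |∇H|² x̄^a dx. -/

import Mathlib

open MeasureTheory Real

noncomputable def xbar (η₀ : ℝ) (x : EuclideanSpace ℝ (Fin 2)) : ℝ :=
  (Real.exp 1 + ‖x‖ ^ 2) ^ ((1 : ℝ) / 2) * Real.log (Real.exp 1 + ‖x‖ ^ 2) ^ (1 + η₀)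

/-- componentwise Laplacian of a vector field on `ℝ²` -/
noncomputable def lapV (H : EuclideanSpace ℝ (Fin 2) → EuclideanSpace ℝ (Fin 2))
    (x : EuclideanSpace ℝ (Fin 2)) : EuclideanSpace ℝ (Fin 2) :=
  ∑ i : Fin 2, iteratedFDeriv ℝ 2 H x (fun _ => EuclideanSpace.single i (1 : ℝ))

abbrev Plane := EuclideanSpace ℝ (Fin 2)

/-- The `i`-th partial derivative of a scalar function on the plane. -/
noncomputable def pd (i : Fin 2) (f : Plane → ℝ) (x : Plane) : ℝ :=
  fderiv ℝ f x (EuclideanSpace.single i 1)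

theorem pd_sub {i : Fin 2} {f g : Plane → ℝ} {x : Plane} (hf : DifferentiableAt ℝ f x)
    (hg : DifferentiableAt ℝ g x) : pd i (fun y => f y - g y) x = pd i f x - pd i g x := by
  simp [pd, fderiv_fun_sub hf hg]

theorem pd_mul {i : Fin 2} {f g : Plane → ℝ} {x : Plane} (hf : DifferentiableAt ℝ f x)
    (hg : DifferentiableAt ℝ g x) :
    pd i (fun y => f y * g y) x = f x * pd i g x + pd i f x * g x := by
  simp [pd, fderiv_fun_mul hf hg, mul_comm]

theorem pd_coord (i j : Fin 2) (x : Plane) :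
    pd i (fun y => y j) x = if j = i then 1 else 0 := by
  have h : HasFDerivAt (fun y : Plane => y j) (EuclideanSpace.proj j : Plane →L[ℝ] ℝ) x :=
    (EuclideanSpace.proj j : Plane →L[ℝ] ℝ).hasFDerivAt
  simp [pd, h.fderiv]

theorem pd_comp {i : Fin 2} {g : ℝ → ℝ} {f : Plane → ℝ} {x : Plane} {g' : ℝ}
    (hg : HasDerivAt g g' (f x)) (hf : DifferentiableAt ℝ f x) :
    pd i (fun y => g (f y)) x = g' * pd i f x := by
  have h := hg.comp_hasFDerivAt x hf.hasFDerivAt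
  have h' : fderiv ℝ (fun y => g (f y)) x = g' • fderiv ℝ f x := h.fderiv
  simp [pd, h']

theorem pd_norm_sq (i : Fin 2) (x : Plane) : pd i (fun y => ‖y‖ ^ 2) x = 2 * x i := by
  simp [pd, EuclideanSpace.inner_single_right]

theorem contDiff_pd {n : WithTop ℕ∞} {f : Plane → ℝ} (i : Fin 2) (hf : ContDiff ℝ (n + 1) f) :
    ContDiff ℝ n (pd i f) :=
  (hf.fderiv_right le_rfl).clm_apply contDiff_const

theorem pd_comm {f : Plane → ℝ} (hf : ContDiff ℝ 2 f) (i j : Fin 2) (x : Plane) :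
    pd i (pd j f) x = pd j (pd i f) x := by
  have hs : IsSymmSndFDerivAt ℝ f x :=
    hf.contDiffAt.isSymmSndFDerivAt (by simp)
  have hd : DifferentiableAt ℝ (fderiv ℝ f) x :=
    ((hf.fderiv_right (m := 1) (by norm_num)).differentiable (by norm_num)) x
  have key : ∀ i j : Fin 2, pd i (pd j f) x =
      fderiv ℝ (fderiv ℝ f) x (EuclideanSpace.single i 1) (EuclideanSpace.single j 1) := by
    intro i j
    have : pd j f = fun y => fderiv ℝ f y (EuclideanSpace.single j 1) := rfl
    rw [this]
    simp [pd, fderiv_clm_apply hd (differentiableAt_const _)]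
  rw [key, key]
  exact hs _ _

/-- A function vanishing on a circle centred at the origin has zero angular derivative there. -/
theorem angular_pd_eq_zero {R : ℝ} {f : Plane → ℝ} (hf : Differentiable ℝ f)
    (h0 : ∀ x ∈ Metric.sphere (0 : Plane) R, f x = 0) :
    ∀ x ∈ Metric.sphere (0 : Plane) R, x 0 * pd 1 f x - x 1 * pd 0 f x = 0 := by
  intro x hx
  set y : Plane := EuclideanSpace.single 0 (-x 1) + EuclideanSpace.single 1 (x 0) with hy
  have hc : HasDerivAt (fun t : ℝ => Real.cos t • x + Real.sin t • y) y 0 := by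
    have h := ((Real.hasDerivAt_cos 0).smul_const x).fun_add
      ((Real.hasDerivAt_sin 0).smul_const y)
    simpa using h
  have hn : ∀ t : ℝ, Real.cos t • x + Real.sin t • y ∈ Metric.sphere (0 : Plane) R := by
    intro t
    have hx' : ‖x‖ = R := by simpa using hx
    rw [mem_sphere_zero_iff_norm, ← hx']
    rw [EuclideanSpace.norm_eq, EuclideanSpace.norm_eq]
    congr 1
    simp [Fin.sum_univ_two, hy]
    linear_combination (x 0 ^ 2 + x 1 ^ 2) * Real.sin_sq_add_cos_sq t
  have hfx : HasFDerivAt f (fderiv ℝ f x) (Real.cos 0 • x + Real.sin 0 • y) := by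
    simpa using (hf x).hasFDerivAt
  have h1 := hfx.comp_hasDerivAt (0 : ℝ) hc
  have h2 : (f ∘ fun t : ℝ => Real.cos t • x + Real.sin t • y) = fun _ => (0 : ℝ) :=
    funext fun t => h0 _ (hn t)
  rw [h2] at h1
  have h3 := h1.unique (hasDerivAt_const _ _)
  have hy' : y = (-x 1) • EuclideanSpace.single 0 (1 : ℝ) + x 0 • EuclideanSpace.single 1 (1 : ℝ) := by
    ext i
    fin_cases i <;> simp [hy]
  rw [hy', map_add, map_smul, map_smul] at h3
  simp only [pd, smul_eq_mul] at h3 ⊢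
  linarith

/-- The boundary flux of the field with divergence `2 (f₁₂² - f₁₁ f₂₂)` is nonpositive. -/
theorem flux_nonpos {R : ℝ} (hR : 0 < R) {f : Plane → ℝ} (hf : ContDiff ℝ 2 f)
    (h0 : ∀ x ∈ Metric.sphere (0 : Plane) R, f x = 0) {x : Plane}
    (hx : x ∈ Metric.sphere (0 : Plane) R) :
    x 0 * (pd 0 (pd 1 f) x * pd 1 f x - pd 1 (pd 1 f) x * pd 0 f x) +
      x 1 * (pd 0 (pd 1 f) x * pd 0 f x - pd 0 (pd 0 f) x * pd 1 f x) ≤ 0 := by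
  have hp : ∀ i, Differentiable ℝ (pd i f) := fun i =>
    (contDiff_pd (n := 1) i (by simpa [one_add_one_eq_two] using hf)).differentiable (by norm_num)
  have hc : ∀ i : Fin 2, Differentiable ℝ (fun y : Plane => y i) := fun i => by fun_prop
  have t1 := angular_pd_eq_zero (hf.differentiable (by norm_num)) h0
  have t2 := angular_pd_eq_zero (f := fun y => y 0 * pd 1 f y - y 1 * pd 0 f y)
    (((hc 0).fun_mul (hp 1)).fun_sub ((hc 1).fun_mul (hp 0))) t1 x hx
  have t1x := t1 x hx
  have hpd : ∀ i, pd i (fun y => y 0 * pd 1 f y - y 1 * pd 0 f y) x =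
      (x 0 * pd i (pd 1 f) x + pd i (fun y => y 0) x * pd 1 f x) -
      (x 1 * pd i (pd 0 f) x + pd i (fun y => y 1) x * pd 0 f x) := by
    intro i
    rw [pd_sub ((hc 0).fun_mul (hp 1) x) ((hc 1).fun_mul (hp 0) x), pd_mul (hc 0 x) (hp 1 x),
      pd_mul (hc 1 x) (hp 0 x)]
  rw [hpd, hpd] at t2
  simp only [pd_coord] at t2
  rw [pd_comm hf 1 0 x] at t2
  norm_num at t2
  have hn : x 0 ^ 2 + x 1 ^ 2 = R ^ 2 := by
    have : ‖x‖ = R := by simpa using hx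
    rw [← this, EuclideanSpace.real_norm_sq_eq, Fin.sum_univ_two]
  generalize pd 0 (pd 1 f) x = h01 at *
  generalize pd 0 (pd 0 f) x = h00 at *
  generalize pd 1 (pd 1 f) x = h11 at *
  generalize pd 0 f x = a at *
  generalize pd 1 f x = b at *
  generalize x 0 = u at *
  generalize x 1 = v at *
  have key : R ^ 2 * (u * (h01 * b - h11 * a) + v * (h01 * a - h00 * b)) = -(u * a + v * b) ^ 2 := by
    rw [← hn]
    linear_combination -(u * a + v * b) * t2 +
      (u ^ 2 * h01 + u * v * h11 - v ^ 2 * h01 - u * v * h00) * t1x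
  have hR2 : 0 < R ^ 2 := by positivity
  nlinarith [sq_nonneg (u * a + v * b)]

theorem integrable_ball_of_continuous {R : ℝ} {f : Plane → ℝ} (hf : Continuous f) :
    IntegrableOn f (Metric.ball (0 : Plane) R) :=
  (hf.continuousOn.integrableOn_compact (isCompact_closedBall (0 : Plane) R)).mono_set
    Metric.ball_subset_closedBall

/-- Integration by parts against a compactly supported function. -/
theorem integral_mul_pd {φ g : Plane → ℝ} (hφ : ContDiff ℝ 1 φ) (hc : HasCompactSupport φ)
    (hg : ContDiff ℝ 1 g) (i : Fin 2) :
    ∫ x, φ x * pd i g x = - ∫ x, pd i φ x * g x := by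
  have hcφ : Continuous (pd i φ) := (contDiff_pd (n := 0) i (by simpa using hφ)).continuous
  have hcg : Continuous (pd i g) := (contDiff_pd (n := 0) i (by simpa using hg)).continuous
  have hs : HasCompactSupport (pd i φ) := hc.fderiv_apply ℝ _
  apply integral_mul_fderiv_eq_neg_fderiv_mul_of_integrable
  · exact (hcφ.mul hg.continuous).integrable_of_hasCompactSupport hs.mul_right
  · exact (hφ.continuous.mul hcg).integrable_of_hasCompactSupport hc.mul_right
  · exact (hφ.continuous.mul hg.continuous).integrable_of_hasCompactSupport hc.mul_right
  · exact fun x _ => hφ.differentiable (by norm_num) x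
  · exact fun x _ => hg.differentiable (by norm_num) x

theorem deriv_smoothTransition_eq_zero {t : ℝ} (ht : t < 0 ∨ 1 < t) :
    deriv smoothTransition t = 0 := by
  rcases ht with ht | ht
  · have : smoothTransition =ᶠ[nhds t] fun _ => (0 : ℝ) := by
      filter_upwards [Iio_mem_nhds ht] with s hs
      exact smoothTransition.zero_of_nonpos (le_of_lt hs)
    simp [this.deriv_eq]
  · have : smoothTransition =ᶠ[nhds t] fun _ => (1 : ℝ) := by
      filter_upwards [Ioi_mem_nhds ht] with s hs
      exact smoothTransition.one_of_one_le (le_of_lt hs)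
    simp [this.deriv_eq]

theorem pd_cutoff (R n : ℝ) (i : Fin 2) (x : Plane) :
    pd i (fun y => smoothTransition (n * (R ^ 2 - ‖y‖ ^ 2))) x =
      -(deriv smoothTransition (n * (R ^ 2 - ‖x‖ ^ 2)) * n * 2 * x i) := by
  have hd : DifferentiableAt ℝ (fun y : Plane => ‖y‖ ^ 2) x :=
    (contDiff_norm_sq ℝ (n := 1)).differentiable (by norm_num) x
  have hg : HasDerivAt (fun s : ℝ => smoothTransition (n * (R ^ 2 - s)))
      (deriv smoothTransition (n * (R ^ 2 - ‖x‖ ^ 2)) * (n * (-1))) (‖x‖ ^ 2) := by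
    have h1 : HasDerivAt smoothTransition (deriv smoothTransition (n * (R ^ 2 - ‖x‖ ^ 2)))
        (n * (R ^ 2 - ‖x‖ ^ 2)) :=
      ((smoothTransition.contDiff (n := 1)).differentiable (by norm_num) _).hasDerivAt
    have h2 := ((hasDerivAt_id (‖x‖ ^ 2)).const_sub (R ^ 2)).const_mul n
    exact h1.comp (‖x‖ ^ 2) h2
  rw [pd_comp (f := fun y => ‖y‖ ^ 2) hg hd, pd_norm_sq]
  ring

theorem integral_divergence_nonpos_of_neg {R : ℝ} (hR : 0 < R) {V : Fin 2 → Plane → ℝ}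
    (hV : ∀ i, ContDiff ℝ 1 (V i))
    (hneg : ∀ x ∈ Metric.sphere (0 : Plane) R, ∑ i, x i * V i x < 0) :
    ∫ x in Metric.ball (0 : Plane) R, ∑ i, pd i (V i) x ≤ 0 := by
  have hVc : ∀ i, Continuous (V i) := fun i => (hV i).continuous
  have hpc : ∀ i, Continuous (pd i (V i)) := fun i =>
    (contDiff_pd (n := 0) i (by simpa using hV i)).continuous
  have hdc : Continuous fun x => ∑ i, pd i (V i) x := continuous_finsetSum _ fun i _ => hpc i
  have hfc : Continuous fun x : Plane => ∑ i, x i * V i x :=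
    continuous_finsetSum _ fun i _ => (by fun_prop : Continuous fun x : Plane => x i).mul (hVc i)
  set φ : ℕ → Plane → ℝ := fun n x => smoothTransition ((n : ℝ) * (R ^ 2 - ‖x‖ ^ 2)) with hφ
  have hφd : ∀ n, ContDiff ℝ 1 (φ n) := fun n =>
    (smoothTransition.contDiff (n := 1)).comp
      (contDiff_const.mul (contDiff_const.sub (contDiff_norm_sq ℝ)))
  have hφ0 : ∀ n, ∀ x ∉ Metric.ball (0 : Plane) R, φ n x = 0 := by
    intro n x hx
    have hx' : R ≤ ‖x‖ := by simpa using hx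
    apply smoothTransition.zero_of_nonpos
    apply mul_nonpos_of_nonneg_of_nonpos (Nat.cast_nonneg n)
    nlinarith
  have hφc : ∀ n, HasCompactSupport (φ n) := fun n =>
    HasCompactSupport.intro (isCompact_closedBall (0 : Plane) R) fun x hx =>
      hφ0 n x fun h => hx (Metric.ball_subset_closedBall h)
  obtain ⟨m, hm, hmA⟩ : ∃ m : ℝ, 0 < m ∧
      ∀ x ∈ Metric.closedBall (0 : Plane) R ∩ {x | 0 ≤ ∑ i, x i * V i x}, m ≤ R ^ 2 - ‖x‖ ^ 2 := by
    apply IsCompact.exists_forall_le'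
      ((isCompact_closedBall (0 : Plane) R).inter_right (isClosed_le continuous_const hfc))
      (by fun_prop)
    rintro x ⟨hx1, hx2⟩
    have hx : ‖x‖ ≤ R := by simpa using hx1
    rcases hx.lt_or_eq with h | h
    · nlinarith [norm_nonneg x]
    · exact absurd hx2 (not_le.2 (hneg x (by simpa using h)))
  have hparts : ∀ n, ∫ x in Metric.ball (0 : Plane) R, φ n x * ∑ i, pd i (V i) x =
      ∫ x, (deriv smoothTransition (n * (R ^ 2 - ‖x‖ ^ 2)) * n * 2) * ∑ i, x i * V i x := by
    intro n
    have hpφ : ∀ i, Continuous (pd i (φ n)) := fun i =>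
      (contDiff_pd (n := 0) i (by simpa using hφd n)).continuous
    have int₁ : ∀ i ∈ Finset.univ, Integrable fun x => φ n x * pd i (V i) x := fun i _ =>
      ((hφd n).continuous.mul (hpc i)).integrable_of_hasCompactSupport (hφc n).mul_right
    have int₂ : ∀ i ∈ Finset.univ, Integrable fun x => -(pd i (φ n) x * V i x) := fun i _ =>
      (((hpφ i).mul (hVc i)).integrable_of_hasCompactSupport
        ((hφc n).fderiv_apply ℝ _).mul_right).neg
    rw [setIntegral_eq_integral_of_forall_compl_eq_zero
      (fun x hx => by rw [hφ0 n x hx, zero_mul])]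
    simp_rw [Finset.mul_sum]
    rw [integral_finsetSum _ int₁]
    simp_rw [integral_mul_pd (hφd n) (hφc n) (hV _)]
    simp_rw [← integral_neg]
    rw [← integral_finsetSum _ int₂]
    congr 1
    ext x
    refine Finset.sum_congr rfl fun i _ => ?_
    rw [hφ, pd_cutoff]
    ring
  have hle : ∀ᶠ n : ℕ in Filter.atTop,
      ∫ x in Metric.ball (0 : Plane) R, φ n x * ∑ i, pd i (V i) x ≤ 0 := by
    obtain ⟨N, hN⟩ := exists_nat_gt (1 / m)
    filter_upwards [Filter.eventually_ge_atTop N] with n hn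
    rw [hparts]
    apply integral_nonpos
    intro x
    have hnm : 1 < n * m := by
      have : (N : ℝ) ≤ n := by exact_mod_cast hn
      rw [div_lt_iff₀ hm] at hN
      nlinarith
    have hn0 : (0 : ℝ) < n := by
      by_contra h
      nlinarith
    have hd0 : 0 ≤ deriv smoothTransition (n * (R ^ 2 - ‖x‖ ^ 2)) :=
      smoothTransition.monotone.deriv_nonneg
    by_cases hx : R ^ 2 - ‖x‖ ^ 2 < 0 ∨ m ≤ R ^ 2 - ‖x‖ ^ 2
    · have : deriv smoothTransition (n * (R ^ 2 - ‖x‖ ^ 2)) = 0 := by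
        apply deriv_smoothTransition_eq_zero
        rcases hx with hx | hx
        · exact Or.inl (mul_neg_of_pos_of_neg hn0 hx)
        · exact Or.inr (by nlinarith)
      simp [this]
    · push Not at hx
      have hxR : x ∈ Metric.closedBall (0 : Plane) R := by
        rw [mem_closedBall_zero_iff]
        exact abs_le_of_sq_le_sq' (by linarith) hR.le |>.2
      have : ∑ i, x i * V i x ≤ 0 := by
        by_contra h
        exact absurd (hmA x ⟨hxR, (not_le.1 h).le⟩) (not_le.2 hx.2)
      exact mul_nonpos_of_nonneg_of_nonpos (by positivity) this
  have hlim : Filter.Tendsto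
      (fun n => ∫ x in Metric.ball (0 : Plane) R, φ n x * ∑ i, pd i (V i) x) Filter.atTop
      (nhds (∫ x in Metric.ball (0 : Plane) R, ∑ i, pd i (V i) x)) := by
    apply tendsto_integral_of_dominated_convergence (fun x => ‖∑ i, pd i (V i) x‖)
    · exact fun n => ((hφd n).continuous.mul hdc).aestronglyMeasurable
    · exact (integrable_ball_of_continuous hdc).norm
    · intro n
      filter_upwards with x
      rw [norm_mul]
      apply mul_le_of_le_one_left (norm_nonneg _)
      rw [Real.norm_of_nonneg (smoothTransition.nonneg _)]
      exact smoothTransition.le_one _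
    · filter_upwards [ae_restrict_mem measurableSet_ball] with x hx
      have hx' : ‖x‖ < R := by simpa using hx
      have hpos : 0 < R ^ 2 - ‖x‖ ^ 2 := by nlinarith [norm_nonneg x]
      obtain ⟨N, hN⟩ := exists_nat_gt (1 / (R ^ 2 - ‖x‖ ^ 2))
      apply tendsto_const_nhds.congr'
      filter_upwards [Filter.eventually_ge_atTop N] with n hn
      have hn' : (N : ℝ) ≤ n := by exact_mod_cast hn
      rw [div_lt_iff₀ hpos] at hN
      rw [hφ]
      simp only
      rw [smoothTransition.one_of_one_le (by nlinarith), one_mul]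
  exact le_of_tendsto hlim hle

/-- A field that does not point outwards on the boundary of a disk has nonpositive total
divergence in the disk. -/
theorem integral_divergence_nonpos {R : ℝ} (hR : 0 < R) {V : Fin 2 → Plane → ℝ}
    (hV : ∀ i, ContDiff ℝ 1 (V i))
    (hneg : ∀ x ∈ Metric.sphere (0 : Plane) R, ∑ i, x i * V i x ≤ 0) :
    ∫ x in Metric.ball (0 : Plane) R, ∑ i, pd i (V i) x ≤ 0 := by
  have hco : ∀ i : Fin 2, ContDiff ℝ 1 fun y : Plane => y i := fun i => by fun_prop
  have hpc : ∀ i, Continuous (pd i (V i)) := fun i =>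
    (contDiff_pd (n := 0) i (by simpa using hV i)).continuous
  have hdc : Continuous fun x => ∑ i, pd i (V i) x := continuous_finsetSum _ fun i _ => hpc i
  set A := volume.real (Metric.ball (0 : Plane) R)
  have key : ∀ δ : ℝ, 0 < δ →
      ∫ x in Metric.ball (0 : Plane) R, ∑ i, pd i (V i) x ≤ A * (2 * δ) := by
    intro δ hδ
    have h := integral_divergence_nonpos_of_neg hR
      (V := fun i x => V i x - δ * x i)
      (fun i => (hV i).sub (contDiff_const.mul (hco i))) (by
        intro x hx
        have hn : ∑ i, x i ^ 2 = R ^ 2 := by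
          have : ‖x‖ = R := by simpa using hx
          rw [← this, EuclideanSpace.real_norm_sq_eq]
        have : ∑ i, x i * (V i x - δ * x i) = ∑ i, x i * V i x - δ * ∑ i, x i ^ 2 := by
          rw [Finset.mul_sum, ← Finset.sum_sub_distrib]
          exact Finset.sum_congr rfl fun i _ => by ring
        rw [this, hn]
        have := hneg x hx
        have : 0 < δ * R ^ 2 := by positivity
        linarith)
    have hpd : ∀ x, ∑ i, pd i (fun x => V i x - δ * x i) x = ∑ i, pd i (V i) x - 2 * δ := by
      intro x
      have : ∀ i, pd i (fun x => V i x - δ * x i) x = pd i (V i) x - δ := by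
        intro i
        have hdi := (hco i).differentiable (by norm_num) x
        rw [pd_sub ((hV i).differentiable (by norm_num) x) (hdi.const_mul δ),
          pd_mul (differentiableAt_const δ) hdi, pd_coord]
        simp [pd]
      simp only [this, Fin.sum_univ_two]
      ring
    simp_rw [hpd] at h
    rw [integral_sub (integrable_ball_of_continuous hdc)
      (integrable_ball_of_continuous continuous_const), setIntegral_const] at h
    simpa [A] using h
  have hlim : Filter.Tendsto (fun δ : ℝ => A * (2 * δ)) (nhdsWithin 0 (Set.Ioi 0)) (nhds 0) := by
    have : Filter.Tendsto (fun δ : ℝ => A * (2 * δ)) (nhds 0) (nhds (A * (2 * 0))) := by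
      apply Continuous.tendsto
      fun_prop
    simpa using this.mono_left nhdsWithin_le_nhds
  exact ge_of_tendsto hlim (by filter_upwards [self_mem_nhdsWithin] with δ hδ using key δ hδ)

/-- The weighted field whose divergence is `2 w (f₁₂² - f₁₁ f₂₂)` up to derivatives of `w`. -/
noncomputable def hessianField (w f : Plane → ℝ) : Fin 2 → Plane → ℝ :=
  ![fun x => w x * (pd 0 (pd 1 f) x * pd 1 f x - pd 1 (pd 1 f) x * pd 0 f x),
    fun x => w x * (pd 0 (pd 1 f) x * pd 0 f x - pd 0 (pd 0 f) x * pd 1 f x)]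

theorem contDiff_hessianField {w f : Plane → ℝ} (hw : ContDiff ℝ 1 w) (hf : ContDiff ℝ 3 f)
    (i : Fin 2) : ContDiff ℝ 1 (hessianField w f i) := by
  have h1 : ∀ i, ContDiff ℝ 2 (pd i f) := fun i => contDiff_pd i (by norm_num; exact hf)
  have h2 : ∀ i j, ContDiff ℝ 1 (pd i (pd j f)) := fun i j =>
    contDiff_pd i (by simpa [one_add_one_eq_two] using h1 j)
  have h1' : ∀ i, ContDiff ℝ 1 (pd i f) := fun i => (h1 i).of_le (by norm_num)
  fin_cases i
  · exact hw.mul (((h2 0 1).mul (h1' 1)).sub ((h2 1 1).mul (h1' 0)))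
  · exact hw.mul (((h2 0 1).mul (h1' 0)).sub ((h2 0 0).mul (h1' 1)))

theorem divergence_hessianField {w f : Plane → ℝ} (hw : ContDiff ℝ 1 w) (hf : ContDiff ℝ 3 f)
    (x : Plane) :
    ∑ i, pd i (hessianField w f i) x =
      w x * (2 * (pd 0 (pd 1 f) x ^ 2 - pd 0 (pd 0 f) x * pd 1 (pd 1 f) x)) +
      pd 0 w x * (pd 0 (pd 1 f) x * pd 1 f x - pd 1 (pd 1 f) x * pd 0 f x) +
      pd 1 w x * (pd 0 (pd 1 f) x * pd 0 f x - pd 0 (pd 0 f) x * pd 1 f x) := by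
  have h1 : ∀ i, ContDiff ℝ 2 (pd i f) := fun i => contDiff_pd i (by norm_num; exact hf)
  have h2 : ∀ i j, ContDiff ℝ 1 (pd i (pd j f)) := fun i j =>
    contDiff_pd i (by simpa [one_add_one_eq_two] using h1 j)
  have d0 : DifferentiableAt ℝ w x := hw.differentiable (by norm_num) x
  have d1 : ∀ i, DifferentiableAt ℝ (pd i f) x := fun i => (h1 i).differentiable (by norm_num) x
  have d2 : ∀ i j, DifferentiableAt ℝ (pd i (pd j f)) x := fun i j =>
    (h2 i j).differentiable (by norm_num) x
  have hf2 : ContDiff ℝ 2 f := hf.of_le (by norm_num)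
  have c01 : pd 1 (pd 0 f) = pd 0 (pd 1 f) := funext fun y => pd_comm hf2 1 0 y
  simp only [hessianField, Fin.sum_univ_two, Matrix.cons_val_zero, Matrix.cons_val_one]
  rw [pd_mul d0 (((d2 0 1).fun_mul (d1 1)).fun_sub ((d2 1 1).fun_mul (d1 0))),
    pd_mul d0 (((d2 0 1).fun_mul (d1 0)).fun_sub ((d2 0 0).fun_mul (d1 1))),
    pd_sub ((d2 0 1).fun_mul (d1 1)) ((d2 1 1).fun_mul (d1 0)),
    pd_sub ((d2 0 1).fun_mul (d1 0)) ((d2 0 0).fun_mul (d1 1)),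
    pd_mul (d2 0 1) (d1 1), pd_mul (d2 1 1) (d1 0), pd_mul (d2 0 1) (d1 0),
    pd_mul (d2 0 0) (d1 1), c01, pd_comm (h1 1) 1 0 x, ← c01, pd_comm (h1 0) 1 0 x, c01]
  ring

theorem integral_divergence_hessianField_nonpos {R : ℝ} (hR : 0 < R) {w f : Plane → ℝ}
    (hw : ContDiff ℝ 1 w) (hw0 : ∀ x, 0 ≤ w x) (hf : ContDiff ℝ 3 f)
    (h0 : ∀ x ∈ Metric.sphere (0 : Plane) R, f x = 0) :
    ∫ x in Metric.ball (0 : Plane) R, ∑ i, pd i (hessianField w f i) x ≤ 0 := by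
  apply integral_divergence_nonpos hR (contDiff_hessianField hw hf)
  intro x hx
  have h := mul_nonpos_of_nonneg_of_nonpos (hw0 x)
    (flux_nonpos hR (hf.of_le (by norm_num)) h0 hx)
  simp only [hessianField, Fin.sum_univ_two, Matrix.cons_val_zero, Matrix.cons_val_one]
  linarith

theorem pd_component {H : Plane → Plane} {x : Plane} (hH : DifferentiableAt ℝ H x) (i j : Fin 2) :
    pd i (fun y => H y j) x = fderiv ℝ H x (EuclideanSpace.single i 1) j := by
  have h : HasFDerivAt (fun y => H y j)
      ((EuclideanSpace.proj j : Plane →L[ℝ] ℝ).comp (fderiv ℝ H x)) x :=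
    (EuclideanSpace.proj j : Plane →L[ℝ] ℝ).hasFDerivAt.comp x hH.hasFDerivAt
  simp [pd, h.fderiv]

theorem pd_pd_component {H : Plane → Plane} (hH : ContDiff ℝ 2 H) (x : Plane) (i j k : Fin 2) :
    pd i (pd k (fun y => H y j)) x =
      fderiv ℝ (fderiv ℝ H) x (EuclideanSpace.single i 1) (EuclideanSpace.single k 1) j := by
  have hd : DifferentiableAt ℝ (fderiv ℝ H) x :=
    (hH.fderiv_right (m := 1) (by norm_num)).differentiable (by norm_num) x
  have h : pd k (fun y => H y j) = fun y => fderiv ℝ H y (EuclideanSpace.single k 1) j :=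
    funext fun y => pd_component (hH.differentiable (by norm_num) y) k j
  rw [h, pd_component (H := fun y => fderiv ℝ H y (EuclideanSpace.single k 1))
    (hd.clm_apply (differentiableAt_const _))]
  simp [fderiv_clm_apply hd (differentiableAt_const _)]

theorem abs_coord_le_norm (v : Plane) (j : Fin 2) : |v j| ≤ ‖v‖ := by
  simpa using PiLp.norm_apply_le v j

theorem abs_pd_component_le {H : Plane → Plane} {x : Plane} (hH : DifferentiableAt ℝ H x)
    (i j : Fin 2) : |pd i (fun y => H y j) x| ≤ ‖fderiv ℝ H x‖ := by
  rw [pd_component hH]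
  refine (abs_coord_le_norm _ j).trans ?_
  simpa using (fderiv ℝ H x).le_opNorm (EuclideanSpace.single i 1)

theorem abs_pd_pd_component_le {H : Plane → Plane} (hH : ContDiff ℝ 2 H) (x : Plane)
    (i j k : Fin 2) : |pd i (pd k (fun y => H y j)) x| ≤ ‖iteratedFDeriv ℝ 2 H x‖ := by
  rw [pd_pd_component hH]
  refine (abs_coord_le_norm _ j).trans ?_
  have h := (iteratedFDeriv ℝ 2 H x).le_opNorm
    ![EuclideanSpace.single i 1, EuclideanSpace.single k 1]
  simpa [iteratedFDeriv_two_apply, Fin.prod_univ_two] using h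

theorem norm_lapV_sq {H : Plane → Plane} (hH : ContDiff ℝ 2 H) (x : Plane) :
    ‖lapV H x‖ ^ 2 = ∑ j : Fin 2,
      (pd 0 (pd 0 (fun y => H y j)) x + pd 1 (pd 1 (fun y => H y j)) x) ^ 2 := by
  rw [EuclideanSpace.real_norm_sq_eq]
  refine Finset.sum_congr rfl fun j _ => ?_
  simp [lapV, iteratedFDeriv_two_apply, Fin.sum_univ_two, pd_pd_component hH]

theorem norm_iteratedFDeriv_two_sq_le {H : Plane → Plane} (hH : ContDiff ℝ 2 H) (x : Plane) :
    ‖iteratedFDeriv ℝ 2 H x‖ ^ 2 ≤ ∑ j : Fin 2,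
      (pd 0 (pd 0 (fun y => H y j)) x ^ 2 + 2 * pd 0 (pd 1 (fun y => H y j)) x ^ 2 +
        pd 1 (pd 1 (fun y => H y j)) x ^ 2) := by
  set S := ∑ j : Fin 2,
      (pd 0 (pd 0 (fun y => H y j)) x ^ 2 + 2 * pd 0 (pd 1 (fun y => H y j)) x ^ 2 +
        pd 1 (pd 1 (fun y => H y j)) x ^ 2) with hS
  have hS0 : 0 ≤ S := Finset.sum_nonneg fun j _ => by positivity
  have hexp : ∀ v : Plane, v = v 0 • EuclideanSpace.single 0 (1 : ℝ) +
      v 1 • EuclideanSpace.single 1 (1 : ℝ) := by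
    intro v
    ext i
    fin_cases i <;> simp
  suffices h : ‖iteratedFDeriv ℝ 2 H x‖ ≤ √S by
    calc ‖iteratedFDeriv ℝ 2 H x‖ ^ 2 ≤ √S ^ 2 := by gcongr
      _ = S := Real.sq_sqrt hS0
  refine ContinuousMultilinearMap.opNorm_le_bound (Real.sqrt_nonneg _) fun m => ?_
  rw [iteratedFDeriv_two_apply, Fin.prod_univ_two]
  refine (abs_le_of_sq_le_sq' ?_ (by positivity)).2
  rw [mul_pow, mul_pow, Real.sq_sqrt hS0, EuclideanSpace.real_norm_sq_eq,
    EuclideanSpace.real_norm_sq_eq (m 0), EuclideanSpace.real_norm_sq_eq (m 1), hS,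
    Finset.sum_mul]
  refine Finset.sum_le_sum fun j _ => ?_
  have hj : ContDiff ℝ 2 fun y => H y j := by fun_prop
  have e : fderiv ℝ (fderiv ℝ H) x (m 0) (m 1) j =
      m 0 0 * m 1 0 * pd 0 (pd 0 (fun y => H y j)) x +
      m 0 0 * m 1 1 * pd 0 (pd 1 (fun y => H y j)) x +
      m 0 1 * m 1 0 * pd 0 (pd 1 (fun y => H y j)) x +
      m 0 1 * m 1 1 * pd 1 (pd 1 (fun y => H y j)) x := by
    conv_lhs => rw [hexp (m 0), hexp (m 1)]
    have hc := pd_comm hj 1 0 x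
    rw [pd_pd_component hH] at hc
    simp only [map_add, map_smul, add_apply, smul_apply,
      PiLp.add_apply, PiLp.smul_apply, smul_eq_mul, hc]
    simp only [pd_pd_component hH]
    ring
  rw [e, Fin.sum_univ_two, Fin.sum_univ_two]
  generalize pd 0 (pd 1 fun y => H y j) x = q
  generalize pd 0 (pd 0 fun y => H y j) x = p
  generalize pd 1 (pd 1 fun y => H y j) x = r
  generalize m 0 0 = a
  generalize m 0 1 = b
  generalize m 1 0 = c
  generalize m 1 1 = d
  nlinarith [sq_nonneg (p * (a * d) - q * (a * c)), sq_nonneg (p * (b * c) - q * (a * c)),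
    sq_nonneg (p * (b * d) - r * (a * c)), sq_nonneg (q * (b * c) - q * (a * d)),
    sq_nonneg (q * (b * d) - r * (a * d)), sq_nonneg (q * (b * d) - r * (b * c))]

theorem weighted_error_le {w w₀ w₁ p q r a b K N M : ℝ} (hw : 0 ≤ w)
    (hw₀ : |w₀| ≤ K * w) (hw₁ : |w₁| ≤ K * w) (hN : 0 ≤ N) (hp : |p| ≤ N) (hq : |q| ≤ N)
    (hr : |r| ≤ N) (ha : |a| ≤ M) (hb : |b| ≤ M) :
    -(w₀ * (q * b - r * a) + w₁ * (q * a - p * b)) ≤ w * (N ^ 2 / 4 + 16 * K ^ 2 * M ^ 2) := by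
  have hM : 0 ≤ M := (abs_nonneg a).trans ha
  have hKw : 0 ≤ K * w := (abs_nonneg _).trans hw₀
  have h2 : ∀ s t u v : ℝ, |s| ≤ N → |t| ≤ M → |u| ≤ N → |v| ≤ M →
      |s * t - u * v| ≤ N * M + N * M := by
    intro s t u v hs ht hu hv
    refine (abs_sub _ _).trans ?_
    rw [abs_mul, abs_mul]
    gcongr
  have h3 : |w₀ * (q * b - r * a)| ≤ K * w * (N * M + N * M) := by
    rw [abs_mul]
    exact mul_le_mul hw₀ (h2 _ _ _ _ hq hb hr ha) (abs_nonneg _) hKw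
  have h4 : |w₁ * (q * a - p * b)| ≤ K * w * (N * M + N * M) := by
    rw [abs_mul]
    exact mul_le_mul hw₁ (h2 _ _ _ _ hq ha hp hb) (abs_nonneg _) hKw
  have h5 : 0 ≤ w * (N / 2 - 4 * K * M) ^ 2 := by positivity
  nlinarith [neg_abs_le (w₀ * (q * b - r * a)), neg_abs_le (w₁ * (q * a - p * b))]

theorem hessian_sq_mul_le {w : Plane → ℝ} {K : ℝ} (hw : ContDiff ℝ 1 w) (hw0 : ∀ x, 0 ≤ w x)
    (hK : ∀ i x, |pd i w x| ≤ K * w x) {H : Plane → Plane} (hH : ContDiff ℝ 3 H) (x : Plane) :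
    ‖iteratedFDeriv ℝ 2 H x‖ ^ 2 * w x ≤ ‖lapV H x‖ ^ 2 * w x +
      (1 / 2) * (‖iteratedFDeriv ℝ 2 H x‖ ^ 2 * w x) +
      32 * K ^ 2 * (‖fderiv ℝ H x‖ ^ 2 * w x) +
      ∑ j : Fin 2, ∑ i, pd i (hessianField w (fun y => H y j) i) x := by
  have hH2 : ContDiff ℝ 2 H := hH.of_le (by norm_num)
  have hd : DifferentiableAt ℝ H x := hH.differentiable (by norm_num) x
  have hj : ∀ j : Fin 2, ContDiff ℝ 3 fun y => H y j := fun j => by fun_prop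
  have h1 := mul_le_mul_of_nonneg_right (norm_iteratedFDeriv_two_sq_le hH2 x) (hw0 x)
  have herr := fun j : Fin 2 => weighted_error_le (hw0 x) (hK 0 x) (hK 1 x)
    (norm_nonneg (iteratedFDeriv ℝ 2 H x)) (abs_pd_pd_component_le hH2 x 0 j 0)
    (abs_pd_pd_component_le hH2 x 0 j 1) (abs_pd_pd_component_le hH2 x 1 j 1)
    (abs_pd_component_le hd 0 j) (abs_pd_component_le hd 1 j)
  have e0 := herr 0
  have e1 := herr 1
  rw [norm_lapV_sq hH2, Fin.sum_univ_two, Fin.sum_univ_two, divergence_hessianField hw (hj 0),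
    divergence_hessianField hw (hj 1)]
  rw [Fin.sum_univ_two] at h1
  nlinarith

theorem integral_hessian_sq_mul_le {R : ℝ} (hR : 0 < R) {w : Plane → ℝ} {K : ℝ}
    (hw : ContDiff ℝ 1 w) (hw0 : ∀ x, 0 ≤ w x) (hK : ∀ i x, |pd i w x| ≤ K * w x)
    {H : Plane → Plane} (hH : ContDiff ℝ 3 H)
    (h0 : ∀ x ∈ Metric.sphere (0 : Plane) R, H x = 0) :
    ∫ x in Metric.ball (0 : Plane) R, ‖iteratedFDeriv ℝ 2 H x‖ ^ 2 * w x ≤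
      (∫ x in Metric.ball (0 : Plane) R, ‖lapV H x‖ ^ 2 * w x) +
      (1 / 2) * (∫ x in Metric.ball (0 : Plane) R, ‖iteratedFDeriv ℝ 2 H x‖ ^ 2 * w x) +
      32 * K ^ 2 * (∫ x in Metric.ball (0 : Plane) R, ‖fderiv ℝ H x‖ ^ 2 * w x) := by
  have hj : ∀ j : Fin 2, ContDiff ℝ 3 fun y => H y j := fun j => by fun_prop
  have c2 : Continuous (iteratedFDeriv ℝ 2 H) := hH.continuous_iteratedFDeriv (by norm_num)
  have cl : Continuous (lapV H) := continuous_finsetSum _ fun i _ => by fun_prop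
  have c1 : Continuous (fderiv ℝ H) := hH.continuous_fderiv (by norm_num)
  have i2 : IntegrableOn (fun x => ‖iteratedFDeriv ℝ 2 H x‖ ^ 2 * w x)
      (Metric.ball (0 : Plane) R) :=
    integrable_ball_of_continuous ((c2.norm.pow 2).mul hw.continuous)
  have il : IntegrableOn (fun x => ‖lapV H x‖ ^ 2 * w x) (Metric.ball (0 : Plane) R) :=
    integrable_ball_of_continuous ((cl.norm.pow 2).mul hw.continuous)
  have i1 : IntegrableOn (fun x => ‖fderiv ℝ H x‖ ^ 2 * w x) (Metric.ball (0 : Plane) R) :=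
    integrable_ball_of_continuous ((c1.norm.pow 2).mul hw.continuous)
  have iv : ∀ j : Fin 2, IntegrableOn
      (fun x => ∑ i, pd i (hessianField w (fun y => H y j) i) x) (Metric.ball (0 : Plane) R) :=
    fun j => integrable_ball_of_continuous (continuous_finsetSum _ fun i _ =>
      (contDiff_pd (n := 0) i (by simpa using contDiff_hessianField hw (hj j) i)).continuous)
  have hmono := setIntegral_mono (s := Metric.ball (0 : Plane) R) i2
    (((il.fun_add (i2.const_mul (1 / 2))).fun_add (i1.const_mul (32 * K ^ 2))).fun_add
      (integrable_finsetSum Finset.univ fun j _ => iv j))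
    (hessian_sq_mul_le hw hw0 hK hH)
  rw [integral_add ((il.fun_add (i2.const_mul (1 / 2))).fun_add (i1.const_mul (32 * K ^ 2)))
      (integrable_finsetSum Finset.univ fun j _ => iv j),
    integral_add (il.fun_add (i2.const_mul (1 / 2))) (i1.const_mul (32 * K ^ 2)),
    integral_add il (i2.const_mul (1 / 2)), integral_const_mul, integral_const_mul,
    integral_finsetSum Finset.univ fun j _ => iv j] at hmono
  have hnp : ∑ j : Fin 2, ∫ x in Metric.ball (0 : Plane) R,
      ∑ i, pd i (hessianField w (fun y => H y j) i) x ≤ 0 :=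
    Finset.sum_nonpos fun j _ => integral_divergence_hessianField_nonpos hR hw hw0 (hj j)
      fun x hx => by simp [h0 x hx]
  linarith

theorem one_le_log_exp_one_add_norm_sq (x : Plane) : 1 ≤ Real.log (Real.exp 1 + ‖x‖ ^ 2) := by
  rw [Real.le_log_iff_exp_le (by positivity)]
  nlinarith [sq_nonneg ‖x‖]

theorem xbar_pos (η₀ : ℝ) (x : Plane) : 0 < xbar η₀ x :=
  mul_pos (Real.rpow_pos_of_pos (by positivity) _)
    (Real.rpow_pos_of_pos (one_pos.trans_le (one_le_log_exp_one_add_norm_sq x)) _)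

theorem xbar_rpow_eq_exp (η₀ a : ℝ) (x : Plane) :
    xbar η₀ x ^ a = Real.exp (a * (1 / 2 * Real.log (Real.exp 1 + ‖x‖ ^ 2) +
      (1 + η₀) * Real.log (Real.log (Real.exp 1 + ‖x‖ ^ 2)))) := by
  have h1 : 0 < Real.exp 1 + ‖x‖ ^ 2 := by positivity
  have h2 : 0 < Real.log (Real.exp 1 + ‖x‖ ^ 2) :=
    one_pos.trans_le (one_le_log_exp_one_add_norm_sq x)
  rw [Real.rpow_def_of_pos (xbar_pos η₀ x), xbar, Real.log_mul (Real.rpow_pos_of_pos h1 _).ne'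
    (Real.rpow_pos_of_pos h2 _).ne', Real.log_rpow h1, Real.log_rpow h2]
  ring_nf

theorem contDiff_xbar_rpow (η₀ a : ℝ) : ContDiff ℝ 1 fun x => xbar η₀ x ^ a := by
  simp_rw [xbar_rpow_eq_exp]
  have h1 : ContDiff ℝ 1 fun x : Plane => Real.log (Real.exp 1 + ‖x‖ ^ 2) :=
    (contDiff_const.add (contDiff_norm_sq ℝ)).log fun x => by positivity
  have h2 : ContDiff ℝ 1 fun x : Plane => Real.log (Real.log (Real.exp 1 + ‖x‖ ^ 2)) :=
    h1.log fun x => (one_pos.trans_le (one_le_log_exp_one_add_norm_sq x)).ne'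
  exact (contDiff_const.mul ((contDiff_const.mul h1).add (contDiff_const.mul h2))).exp

theorem abs_pd_xbar_rpow_le {η₀ a : ℝ} (hη₀ : 0 < η₀) (ha : 0 < a) (i : Fin 2) (x : Plane) :
    |pd i (fun x => xbar η₀ x ^ a) x| ≤ a * (3 / 2 + η₀) * xbar η₀ x ^ a := by
  have hs : 0 < Real.exp 1 + ‖x‖ ^ 2 := by positivity
  have hl := one_le_log_exp_one_add_norm_sq x
  have hlog : HasDerivAt (fun s : ℝ => Real.log (Real.exp 1 + s))
      (1 / (Real.exp 1 + ‖x‖ ^ 2)) (‖x‖ ^ 2) :=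
    ((hasDerivAt_id _).const_add (Real.exp 1)).log hs.ne'
  have hg := (((hlog.const_mul (1 / 2)).fun_add
    ((hlog.log (one_pos.trans_le hl).ne').const_mul (1 + η₀))).const_mul a).exp
  have hd : DifferentiableAt ℝ (fun y : Plane => ‖y‖ ^ 2) x :=
    (contDiff_norm_sq ℝ (n := 1)).differentiable (by norm_num) x
  simp_rw [xbar_rpow_eq_exp]
  rw [pd_comp (f := fun y : Plane => ‖y‖ ^ 2) hg hd, pd_norm_sq, mul_assoc, abs_mul, Real.abs_exp,
    mul_comm]
  refine mul_le_mul_of_nonneg_right ?_ (Real.exp_pos _).le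
  have hx : |2 * x i| ≤ Real.exp 1 + ‖x‖ ^ 2 := by
    have h1 := abs_coord_le_norm x i
    have h2 : (1 : ℝ) ≤ Real.exp 1 := Real.one_le_exp zero_le_one
    rw [abs_mul, abs_two]
    nlinarith [sq_nonneg (‖x‖ - 1)]
  generalize Real.log (Real.exp 1 + ‖x‖ ^ 2) = l at *
  generalize Real.exp 1 + ‖x‖ ^ 2 = s at *
  have e : a * (1 / 2 * (1 / s) + (1 + η₀) * (1 / s / l)) * (2 * x i) =
      a * (1 / 2 + (1 + η₀) * (1 / l)) * (2 * x i / s) := by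
    ring
  have hl' : 1 / l ≤ 1 := by rw [div_le_one (by linarith)]; exact hl
  have hl0 : 0 < 1 / l := by positivity
  have hq : |2 * x i / s| ≤ 1 := by
    rw [abs_div, abs_of_pos hs, div_le_one hs]
    exact hx
  rw [e, abs_mul, abs_of_pos (by positivity)]
  calc a * (1 / 2 + (1 + η₀) * (1 / l)) * |2 * x i / s|
      ≤ a * (1 / 2 + (1 + η₀) * 1) * 1 := by gcongr
    _ = a * (3 / 2 + η₀) := by ring

/-- weighted Hessian control
`∫|∇²H|² x̄^a ≤ ∫|ΔH|² x̄^a + ½∫|∇²H|² x̄^a + C∫|∇H|² x̄^a`, and consequently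
`∫|∇²H|² x̄^a ≤ 2∫|ΔH|² x̄^a + 2C∫|∇H|² x̄^a`. -/
theorem stmt5 (η₀ a : ℝ) (hη₀ : 0 < η₀) (ha : 0 < a) :
    ∃ C : ℝ, 0 < C ∧ ∀ R : ℝ, 0 < R →
      ∀ H : EuclideanSpace ℝ (Fin 2) → EuclideanSpace ℝ (Fin 2),
        ContDiff ℝ (⊤ : ℕ∞) H →
        (∀ x ∈ Metric.sphere (0 : EuclideanSpace ℝ (Fin 2)) R, H x = 0) →
        ((∫ x in Metric.ball (0 : EuclideanSpace ℝ (Fin 2)) R,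
              ‖iteratedFDeriv ℝ 2 H x‖ ^ 2 * xbar η₀ x ^ a)
            ≤ (∫ x in Metric.ball (0 : EuclideanSpace ℝ (Fin 2)) R,
                ‖lapV H x‖ ^ 2 * xbar η₀ x ^ a)
              + (1 / 2) * (∫ x in Metric.ball (0 : EuclideanSpace ℝ (Fin 2)) R,
                  ‖iteratedFDeriv ℝ 2 H x‖ ^ 2 * xbar η₀ x ^ a)
              + C * (∫ x in Metric.ball (0 : EuclideanSpace ℝ (Fin 2)) R,
                  ‖fderiv ℝ H x‖ ^ 2 * xbar η₀ x ^ a))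
        ∧ (∫ x in Metric.ball (0 : EuclideanSpace ℝ (Fin 2)) R,
              ‖iteratedFDeriv ℝ 2 H x‖ ^ 2 * xbar η₀ x ^ a)
            ≤ 2 * (∫ x in Metric.ball (0 : EuclideanSpace ℝ (Fin 2)) R,
                ‖lapV H x‖ ^ 2 * xbar η₀ x ^ a)
              + 2 * C * (∫ x in Metric.ball (0 : EuclideanSpace ℝ (Fin 2)) R,
                  ‖fderiv ℝ H x‖ ^ 2 * xbar η₀ x ^ a) := by
  refine ⟨32 * (a * (3 / 2 + η₀)) ^ 2, by positivity, fun R hR H hH h0 => ?_⟩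
  have h := integral_hessian_sq_mul_le hR (contDiff_xbar_rpow η₀ a)
    (fun x => (Real.rpow_pos_of_pos (xbar_pos η₀ x) a).le) (abs_pd_xbar_rpow_le hη₀ ha)
    (contDiff_infty.1 hH 3) h0
  exact ⟨h, by linarith⟩
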